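/- arXiv:1210.2814 — 9 statements merged into one kernel-verified Lean document; each statement's English description precedes it below -/
import Mathlib

section
/- For every positive integer n, the number of n²×n² S-permutation matrices is exactly (n!)^(2n). -/
/-- An S-permutation matrix: an `n² × n²` binary matrix (rows and columns indexed by
`Fin n × Fin n`, where `(k, i)` means position `i` inside block `k`) with exactly one `1`
in every row, every column, and every block. -/
def IsSPerm (n : ℕ) (A : Matrix (Fin n × Fin n) (Fin n × Fin n) ℤ) : Prop :=
  (∀ i j, A i j = 0 ∨ A i j = 1) ∧
  (∀ r, ∃! c, A r c = 1) ∧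
  (∀ c, ∃! r, A r c = 1) ∧
  (∀ k l : Fin n, ∃! p : Fin n × Fin n, A (k, p.1) (l, p.2) = 1)

/-- Two binary matrices are disjoint if there is no position where both have entry `1`. -/
def DisjMat (n : ℕ) (A B : Matrix (Fin n × Fin n) (Fin n × Fin n) ℤ) : Prop :=
  ∀ i j, ¬ (A i j = 1 ∧ B i j = 1)

/-- The binary matrix whose block `(k, l)` has its only `1` in row `σ k l` and column `τ l k`. -/
def blockPermMatrix {n : ℕ} (p : (Fin n → Equiv.Perm (Fin n)) × (Fin n → Equiv.Perm (Fin n))) :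
    Matrix (Fin n × Fin n) (Fin n × Fin n) ℤ :=
  fun r c => if p.1 r.1 c.1 = r.2 ∧ p.2 c.1 r.1 = c.2 then 1 else 0

lemma blockPermMatrix_eq_one {n : ℕ}
    (p : (Fin n → Equiv.Perm (Fin n)) × (Fin n → Equiv.Perm (Fin n))) (k i l j : Fin n) :
    blockPermMatrix p (k, i) (l, j) = 1 ↔ p.1 k l = i ∧ p.2 l k = j := by
  simp [blockPermMatrix]

lemma blockPermMatrix_injective (n : ℕ) : Function.Injective (blockPermMatrix (n := n)) := by
  intro p q h
  have key (k l : Fin n) : q.1 k l = p.1 k l ∧ q.2 l k = p.2 l k := by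
    have hp := (blockPermMatrix_eq_one p k (p.1 k l) l (p.2 l k)).2 ⟨rfl, rfl⟩
    rw [h] at hp
    exact (blockPermMatrix_eq_one q _ _ _ _).1 hp
  refine Prod.ext ?_ ?_
  · ext k l : 2
    exact (key k l).1.symm
  · ext l k : 2
    exact (key k l).2.symm

lemma isSPerm_blockPermMatrix {n : ℕ}
    (p : (Fin n → Equiv.Perm (Fin n)) × (Fin n → Equiv.Perm (Fin n))) :
    IsSPerm n (blockPermMatrix p) := by
  refine ⟨fun r c => ?_, fun ⟨k, i⟩ => ?_, fun ⟨l, j⟩ => ?_, fun k l => ?_⟩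
  · unfold blockPermMatrix
    split_ifs <;> simp
  · refine ⟨((p.1 k).symm i, p.2 ((p.1 k).symm i) k), ?_, ?_⟩
    · simp [blockPermMatrix_eq_one]
    · rintro ⟨l, j⟩ h
      obtain ⟨rfl, rfl⟩ := (blockPermMatrix_eq_one p _ _ _ _).1 h
      simp
  · refine ⟨((p.2 l).symm j, p.1 ((p.2 l).symm j) l), ?_, ?_⟩
    · simp [blockPermMatrix_eq_one]
    · rintro ⟨k, i⟩ h
      obtain ⟨rfl, rfl⟩ := (blockPermMatrix_eq_one p _ _ _ _).1 h
      simp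
  · refine ⟨(p.1 k l, p.2 l k), (blockPermMatrix_eq_one p _ _ _ _).2 ⟨rfl, rfl⟩, ?_⟩
    rintro ⟨i, j⟩ h
    obtain ⟨rfl, rfl⟩ := (blockPermMatrix_eq_one p _ _ _ _).1 h
    rfl

lemma IsSPerm.exists_blockPermMatrix_eq {n : ℕ} {A : Matrix (Fin n × Fin n) (Fin n × Fin n) ℤ}
    (hA : IsSPerm n A) : ∃ p, blockPermMatrix p = A := by
  obtain ⟨hbin, hrow, hcol, hblock⟩ := hA
  choose f hf hf_unique using hblock
  beta_reduce at hf hf_unique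
  have hσ (k : Fin n) : Function.Injective fun l => (f k l).1 := by
    intro l l' h
    have h' := hf k l'
    rw [← show (f k l).1 = (f k l').1 from h] at h'
    exact congrArg Prod.fst ((hrow _).unique (hf k l) h')
  have hτ (l : Fin n) : Function.Injective fun k => (f k l).2 := by
    intro k k' h
    have h' := hf k' l
    rw [← show (f k l).2 = (f k' l).2 from h] at h'
    exact congrArg Prod.fst ((hcol _).unique (hf k l) h')
  let p : (Fin n → Equiv.Perm (Fin n)) × (Fin n → Equiv.Perm (Fin n)) :=
    (fun k => Equiv.ofBijective _ (Finite.injective_iff_bijective.1 (hσ k)),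
      fun l => Equiv.ofBijective _ (Finite.injective_iff_bijective.1 (hτ l)))
  have hp (r c : Fin n × Fin n) : blockPermMatrix p r c = 1 ↔ A r c = 1 := by
    obtain ⟨k, i⟩ := r
    obtain ⟨l, j⟩ := c
    rw [blockPermMatrix_eq_one]
    change (f k l).1 = i ∧ (f k l).2 = j ↔ _
    constructor
    · rintro ⟨rfl, rfl⟩
      exact hf k l
    · intro h
      simp [← hf_unique k l (i, j) h]
  refine ⟨p, ?_⟩
  ext r c
  have h := hp r c
  rcases (isSPerm_blockPermMatrix p).1 r c with h₁ | h₁ <;> rcases hbin r c with h₂ | h₂ <;>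
    simp_all

/-- The number of n²×n² S-permutation matrices is exactly (n!)^(2n). -/
theorem card_sperm (n : ℕ) (hn : 0 < n) :
    {A : Matrix (Fin n × Fin n) (Fin n × Fin n) ℤ | IsSPerm n A}.ncard =
      n.factorial ^ (2 * n) := by
  have hrange : {A : Matrix (Fin n × Fin n) (Fin n × Fin n) ℤ | IsSPerm n A} =
      Set.range blockPermMatrix := by
    ext A
    constructor
    · exact IsSPerm.exists_blockPermMatrix_eq
    · rintro ⟨p, rfl⟩
      exact isSPerm_blockPermMatrix p
  rw [hrange, ← Set.image_univ, Set.ncard_image_of_injective _ (blockPermMatrix_injective n),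
    Set.ncard_univ, Nat.card_eq_fintype_card]
  simp [Fintype.card_perm, two_mul, pow_add]
end

section
/- Let n be a positive integer and let A and B be n²×n² S-permutation matrices. Then there exist unique block-diagonal n²×n² permutation matrices C and D (i.e., C and D are permutation matrices whose (k,l)-block is the zero matrix whenever k ≠ l, so each diagonal block C_k, D_k is an n×n permutation matrix) such that B = C·A·D. -/
/-- A permutation matrix: a square binary matrix with exactly one `1` in every
row and every column. -/
def IsPermMatrix (n : ℕ) (P : Matrix (Fin n × Fin n) (Fin n × Fin n) ℤ) : Prop :=
  (∀ i j, P i j = 0 ∨ P i j = 1) ∧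
  (∀ i, ∃! j, P i j = 1) ∧
  (∀ j, ∃! i, P i j = 1)

/-- Block-diagonal: the `(k, l)`-block is zero whenever `k ≠ l`. -/
def IsBlockDiag (n : ℕ) (P : Matrix (Fin n × Fin n) (Fin n × Fin n) ℤ) : Prop :=
  ∀ k l i j : Fin n, k ≠ l → P (k, i) (l, j) = 0

open Equiv in
theorem permMatrix_int_apply {ι : Type*} [DecidableEq ι] (σ : Perm ι) (x y : ι) :
    σ.permMatrix ℤ x y = if σ x = y then 1 else 0 := by
  simp [Perm.permMatrix, PEquiv.toMatrix_apply, eq_comm]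

open Equiv in
theorem permMatrix_int_injective {ι : Type*} [DecidableEq ι] :
    Function.Injective fun σ : Perm ι => σ.permMatrix ℤ := by
  intro σ τ h
  ext1 x
  have h' := congrFun (congrFun h x) (σ x)
  simp only [permMatrix_int_apply] at h'
  by_contra hne
  simp [Ne.symm hne] at h'

open Equiv in
theorem isPermMatrix_permMatrix (n : ℕ) (σ : Perm (Fin n × Fin n)) :
    IsPermMatrix n (σ.permMatrix ℤ) := by
  refine ⟨fun i j => ?_, fun i => ⟨σ i, ?_, ?_⟩, fun j => ⟨σ.symm j, ?_, ?_⟩⟩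
  · rw [permMatrix_int_apply]
    split_ifs <;> simp
  · simp
  · intro y hy
    simpa [permMatrix_int_apply, eq_comm] using hy
  · simp
  · intro y hy
    simpa [permMatrix_int_apply, Equiv.eq_symm_apply] using hy

open Equiv in
theorem IsPermMatrix.exists_eq_permMatrix {n : ℕ}
    {P : Matrix (Fin n × Fin n) (Fin n × Fin n) ℤ} (hP : IsPermMatrix n P) :
    ∃ σ : Perm (Fin n × Fin n), P = σ.permMatrix ℤ := by
  obtain ⟨hbin, hrow, hcol⟩ := hP
  choose f hf hf_unique using hrow
  have hinj : Function.Injective f := fun x y hxy =>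
    (hcol (f x)).unique (hf x) (by rw [hxy]; exact hf y)
  refine ⟨Equiv.ofBijective f (Finite.injective_iff_bijective.mp hinj), ?_⟩
  ext x y
  rw [permMatrix_int_apply, Equiv.ofBijective_apply]
  split_ifs with h
  · exact h ▸ hf x
  · exact (hbin x y).resolve_right fun h1 => h (hf_unique x y h1).symm

theorem IsSPerm.isPermMatrix {n : ℕ} {A : Matrix (Fin n × Fin n) (Fin n × Fin n) ℤ}
    (hA : IsSPerm n A) : IsPermMatrix n A :=
  ⟨hA.1, hA.2.1, hA.2.2.1⟩

open Equiv in
theorem isBlockDiag_permMatrix_iff {n : ℕ} {σ : Perm (Fin n × Fin n)} :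
    IsBlockDiag n (σ.permMatrix ℤ) ↔ ∀ x, (σ x).1 = x.1 := by
  constructor
  · intro h x
    by_contra hne
    have h0 := h x.1 (σ x).1 x.2 (σ x).2 (Ne.symm hne)
    simp at h0
  · intro h k l i j hkl
    rw [permMatrix_int_apply, if_neg]
    intro hσ
    exact hkl (by simpa [hσ] using (h (k, i)).symm)

open Equiv in
/-- Each row block of an S-permutation matrix meets every column block in exactly one row, so
sending a row to its block together with the block of its nonzero column is bijective. -/
theorem IsSPerm.bijective_block {n : ℕ} {σ : Perm (Fin n × Fin n)}
    (h : IsSPerm n (σ.permMatrix ℤ)) :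
    Function.Bijective fun x : Fin n × Fin n => (x.1, (σ x).1) := by
  refine Finite.injective_iff_bijective.mp ?_
  rintro ⟨k, i⟩ ⟨k', i'⟩ hxy
  obtain ⟨rfl, hl⟩ := Prod.mk.inj hxy
  have hu := (h.2.2.2 k (σ (k, i)).1).unique
    (y₁ := (i, (σ (k, i)).2)) (y₂ := (i', (σ (k, i')).2))
    (by simp) (by
      rw [permMatrix_int_apply, if_pos]
      exact Prod.ext hl.symm rfl)
  rw [(Prod.mk.inj hu).1]

open Equiv in
theorem existsUnique_blockPreserving_factorization {ι κ : Type*} {α β : Perm (ι × κ)}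
    (hα : Function.Bijective fun x : ι × κ => (x.1, (α x).1))
    (hβ : Function.Bijective fun x : ι × κ => (x.1, (β x).1)) :
    ∃! γδ : Perm (ι × κ) × Perm (ι × κ),
      ((∀ x, (γδ.1 x).1 = x.1) ∧ ∀ x, (γδ.2 x).1 = x.1) ∧ β = γδ.2 * (α * γδ.1) := by
  let φ : ι × κ ≃ ι × ι := Equiv.ofBijective _ hα
  let ψ : ι × κ ≃ ι × ι := Equiv.ofBijective _ hβ
  obtain ⟨γ, hγ⟩ : ∃ γ : Perm (ι × κ), ∀ x, φ (γ x) = ψ x :=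
    ⟨ψ.trans φ.symm, by simp⟩
  simp only [φ, ψ, Equiv.ofBijective_apply, Prod.mk.injEq] at hγ
  refine ⟨(γ, β * (α * γ)⁻¹), ⟨⟨fun x => (hγ x).1, fun x => ?_⟩,
    (inv_mul_cancel_right β (α * γ)).symm⟩, ?_⟩
  · obtain ⟨y, rfl⟩ := (α * γ).surjective x
    simpa using (hγ y).2.symm
  · rintro ⟨γ', δ'⟩ ⟨⟨hγ', hδ'⟩, hfac⟩
    have hγ_eq : γ' = γ := by
      ext1 x
      apply hα.injective
      have hβx : (β x).1 = (α (γ' x)).1 := by simp [hfac, hδ']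
      simp only [Prod.mk.injEq]
      exact ⟨(hγ' x).trans (hγ x).1.symm, hβx.symm.trans (hγ x).2.symm⟩
    subst hγ_eq
    exact Prod.ext rfl (eq_mul_inv_of_mul_eq hfac.symm)

/-- For S-permutation matrices A and B there exist unique block-diagonal permutation
matrices C and D with B = C · A · D. -/
theorem exists_unique_blockdiag_factorization (n : ℕ) (hn : 0 < n)
    (A B : Matrix (Fin n × Fin n) (Fin n × Fin n) ℤ)
    (hA : IsSPerm n A) (hB : IsSPerm n B) :
    ∃! CD : Matrix (Fin n × Fin n) (Fin n × Fin n) ℤ ×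
            Matrix (Fin n × Fin n) (Fin n × Fin n) ℤ,
      (IsPermMatrix n CD.1 ∧ IsBlockDiag n CD.1 ∧
       IsPermMatrix n CD.2 ∧ IsBlockDiag n CD.2) ∧ B = CD.1 * A * CD.2 := by
  obtain ⟨α, rfl⟩ := hA.isPermMatrix.exists_eq_permMatrix
  obtain ⟨β, rfl⟩ := hB.isPermMatrix.exists_eq_permMatrix
  obtain ⟨⟨γ, δ⟩, ⟨⟨hγ, hδ⟩, hfac⟩, huniq⟩ :=
    existsUnique_blockPreserving_factorization hA.bijective_block hB.bijective_block
  refine ⟨(γ.permMatrix ℤ, δ.permMatrix ℤ), ⟨⟨isPermMatrix_permMatrix n γ,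
    isBlockDiag_permMatrix_iff.mpr hγ, isPermMatrix_permMatrix n δ,
    isBlockDiag_permMatrix_iff.mpr hδ⟩, ?_⟩, ?_⟩
  · simp only [← Matrix.permMatrix_mul]
    rw [← hfac]
  · rintro ⟨C, D⟩ ⟨⟨hC, hCd, hD, hDd⟩, hCD⟩
    obtain ⟨γ', rfl⟩ := hC.exists_eq_permMatrix
    obtain ⟨δ', rfl⟩ := hD.exists_eq_permMatrix
    simp only [← Matrix.permMatrix_mul] at hCD
    have h := huniq (γ', δ') ⟨⟨isBlockDiag_permMatrix_iff.mp hCd,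
      isBlockDiag_permMatrix_iff.mp hDd⟩, permMatrix_int_injective hCD⟩
    obtain ⟨rfl, rfl⟩ := Prod.mk.inj h
    rfl
end

section
/- Let n be a positive integer, let A be an n²×n² S-permutation matrix, and let C and D be block-diagonal n²×n² permutation matrices with diagonal n×n blocks C_1,…,C_n and D_1,…,D_n respectively. If the permutation corresponding to C_k is a derangement of Fin n for every k = 1,…,n, or the permutation corresponding to D_k is a derangement of Fin n for every k = 1,…,n, then A and C·A·D are disjoint. -/
/-- If every diagonal block of C corresponds to a derangement, or every diagonal block
of D corresponds to a derangement, then A and C·A·D are disjoint.  (The permutation ρ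
corresponding to the block C_k satisfies ρ(i) = j ⟺ C (k,i) (k,j) = 1; being a
derangement means C (k,i) (k,i) ≠ 1 for all i.) -/
theorem disjoint_of_derangement_blocks (n : ℕ) (hn : 0 < n)
    (A C D : Matrix (Fin n × Fin n) (Fin n × Fin n) ℤ)
    (hA : IsSPerm n A)
    (hC : IsPermMatrix n C) (hCbd : IsBlockDiag n C)
    (hD : IsPermMatrix n D) (hDbd : IsBlockDiag n D)
    (hder : (∀ k i : Fin n, C (k, i) (k, i) ≠ 1) ∨
            (∀ k i : Fin n, D (k, i) (k, i) ≠ 1)) :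
    DisjMat n A (C * A * D) := by
  rintro ⟨k, i⟩ ⟨l, j⟩ ⟨hkl, hprod⟩
  have hne : (C * A * D) (k, i) (l, j) ≠ 0 := by simp [hprod]
  rw [Matrix.mul_apply] at hne
  obtain ⟨⟨l', j'⟩, -, ht⟩ := Finset.exists_ne_zero_of_sum_ne_zero hne
  have hCA := left_ne_zero_of_mul ht
  have hDt := right_ne_zero_of_mul ht
  rw [Matrix.mul_apply] at hCA
  obtain ⟨⟨k', i'⟩, -, hs⟩ := Finset.exists_ne_zero_of_sum_ne_zero hCA
  have hCs := left_ne_zero_of_mul hs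
  have hAst := (hA.1 _ _).resolve_left (right_ne_zero_of_mul hs)
  obtain rfl : k = k' := by
    by_contra h
    exact hCs (hCbd _ _ _ _ h)
  obtain rfl : l' = l := by
    by_contra h
    exact hDt (hDbd _ _ _ _ h)
  have hpos : (i, j) = (i', j') := (hA.2.2.2 k l').unique hkl hAst
  obtain ⟨rfl, rfl⟩ := Prod.mk.inj hpos
  rcases hder with h | h
  · exact h _ _ ((hC.1 _ _).resolve_left hCs)
  · exact h _ _ ((hD.1 _ _).resolve_left hDt)
end

section
/- Let n be a positive integer. The number ξ_n of n²×n² S-permutation matrices B disjoint with a given S-permutation matrix A does not depend on the choice of A; that is, for any two S-permutation matrices A and A′, the set of S-permutation matrices disjoint with A and the set of S-permutation matrices disjoint with A′ have the same cardinality. -/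
namespace IsSPerm

variable {n : ℕ} {A A' : Matrix (Fin n × Fin n) (Fin n × Fin n) ℤ}

/-- Two entries `1` of an S-permutation matrix lying in the same block coincide. -/
theorem eq_of_block_eq (hA : IsSPerm n A) {r r' c c' : Fin n × Fin n}
    (h : A r c = 1) (h' : A r' c' = 1) (hr : r.1 = r'.1) (hc : c.1 = c'.1) :
    r = r' ∧ c = c' := by
  obtain ⟨k, i⟩ := r
  obtain ⟨k', i'⟩ := r'
  obtain ⟨l, j⟩ := c
  obtain ⟨l', j'⟩ := c'
  obtain rfl : k = k' := hr
  obtain rfl : l = l' := hc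
  have := (hA.2.2.2 k l).unique (y₁ := (i, j)) (y₂ := (i', j')) h h'
  simp_all

/-- Permuting rows and columns within their blocks preserves S-permutation matrices. -/
theorem submatrix (hA : IsSPerm n A) {e f : Equiv.Perm (Fin n × Fin n)}
    (he : ∀ r, (e r).1 = r.1) (hf : ∀ c, (f c).1 = c.1) : IsSPerm n (A.submatrix e f) := by
  refine ⟨fun i j => hA.1 _ _, fun r => ?_, fun c => ?_, fun k l => ?_⟩
  · exact f.bijective.existsUnique_iff.1 (hA.2.1 (e r))
  · exact e.bijective.existsUnique_iff.1 (hA.2.2.1 (f c))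
  · obtain ⟨⟨i, j⟩, hij, -⟩ := hA.2.2.2 k l
    have hr : (e.symm (k, i)).1 = k := by simpa using (he (e.symm (k, i))).symm
    have hc : (f.symm (l, j)).1 = l := by simpa using (hf (f.symm (l, j))).symm
    have hr' : (k, (e.symm (k, i)).2) = e.symm (k, i) := Prod.ext hr.symm rfl
    have hc' : (l, (f.symm (l, j)).2) = f.symm (l, j) := Prod.ext hc.symm rfl
    refine ⟨((e.symm (k, i)).2, (f.symm (l, j)).2), by simpa [hr', hc'] using hij, ?_⟩
    rintro ⟨i', j'⟩ h
    obtain ⟨h₁, h₂⟩ := hA.eq_of_block_eq (r' := (k, i)) (c' := (l, j)) h hij (he _) (hf _)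
    simp [← h₁, ← h₂]

/-- Sending each row `(k, i)` to `(k, l)`, where `l` is the block column of the `1` in that row,
and similarly for columns, brings an S-permutation matrix to the canonical one. -/
theorem exists_perm_canonical (hA : IsSPerm n A) :
    ∃ e f : Equiv.Perm (Fin n × Fin n), (∀ r, (e r).1 = r.1) ∧ (∀ c, (f c).1 = c.1) ∧
      ∀ r c, A r c = 1 ↔ (e r).2 = c.1 ∧ (f c).2 = r.1 := by
  choose u hu hu' using hA.2.1
  choose v hv hv' using hA.2.2.1
  have hinj : Function.Injective fun r : Fin n × Fin n => (r.1, (u r).1) := fun r r' h =>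
    (hA.eq_of_block_eq (hu r) (hu r') (Prod.mk.inj h).1 (Prod.mk.inj h).2).1
  have hinj' : Function.Injective fun c : Fin n × Fin n => (c.1, (v c).1) := fun c c' h =>
    (hA.eq_of_block_eq (hv c) (hv c') (Prod.mk.inj h).2 (Prod.mk.inj h).1).2
  refine ⟨Equiv.ofBijective _ (Finite.injective_iff_bijective.1 hinj),
    Equiv.ofBijective _ (Finite.injective_iff_bijective.1 hinj'), fun _ => rfl, fun _ => rfl,
    fun r c => ⟨fun h => ⟨?_, ?_⟩, fun ⟨h₁, h₂⟩ => ?_⟩⟩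
  · exact congrArg Prod.fst (hu' r c h).symm
  · exact congrArg Prod.fst (hv' c r h).symm
  · have h := (hA.eq_of_block_eq (hu r) (hv c) h₂.symm h₁).2
    exact h ▸ hu r

/-- Any two S-permutation matrices differ by permutations of rows and columns within blocks. -/
theorem exists_perm_relating (hA : IsSPerm n A) (hA' : IsSPerm n A') :
    ∃ e f : Equiv.Perm (Fin n × Fin n), (∀ r, (e r).1 = r.1) ∧ (∀ c, (f c).1 = c.1) ∧
      ∀ r c, A' r c = 1 ↔ A (e r) (f c) = 1 := by
  obtain ⟨e, f, he, hf, h⟩ := hA.exists_perm_canonical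
  obtain ⟨e', f', he', hf', h'⟩ := hA'.exists_perm_canonical
  have hr : ∀ r, (e.symm (e' r)).1 = r.1 := fun r => by
    rw [← he, e.apply_symm_apply, he']
  have hc : ∀ c, (f.symm (f' c)).1 = c.1 := fun c => by
    rw [← hf, f.apply_symm_apply, hf']
  exact ⟨e'.trans e.symm, f'.trans f.symm, hr, hc, fun r c => by simp [h, h', hr, hc]⟩

end IsSPerm

/-- The number of S-permutation matrices disjoint with a given S-permutation matrix
does not depend on the choice of that matrix. -/
theorem card_disjoint_independent (n : ℕ) (hn : 0 < n)
    (A A' : Matrix (Fin n × Fin n) (Fin n × Fin n) ℤ)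
    (hA : IsSPerm n A) (hA' : IsSPerm n A') :
    {B : Matrix (Fin n × Fin n) (Fin n × Fin n) ℤ |
        IsSPerm n B ∧ DisjMat n A B}.ncard =
    {B : Matrix (Fin n × Fin n) (Fin n × Fin n) ℤ |
        IsSPerm n B ∧ DisjMat n A' B}.ncard := by
  obtain ⟨e, f, he, hf, hef⟩ := hA.exists_perm_relating hA'
  have he' : ∀ r, (e.symm r).1 = r.1 := fun r => by simpa using (he (e.symm r)).symm
  have hf' : ∀ c, (f.symm c).1 = c.1 := fun c => by simpa using (hf (f.symm c)).symm
  refine Set.ncard_congr (fun B _ => B.submatrix e f) ?_ ?_ ?_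
  · rintro B ⟨hB, hAB⟩
    exact ⟨hB.submatrix he hf, fun r c h => hAB (e r) (f c) ⟨(hef r c).1 h.1, h.2⟩⟩
  · intro B C _ _ h
    ext r c
    simpa using congrFun (congrFun h (e.symm r)) (f.symm c)
  · rintro B ⟨hB, hAB⟩
    refine ⟨B.submatrix e.symm f.symm, ⟨hB.submatrix he' hf', fun r c h => ?_⟩, by simp⟩
    exact hAB (e.symm r) (f.symm c) ⟨(hef _ _).2 (by simpa using h.1), h.2⟩
end

section
/- Let n be a positive integer. The probability that two distinct n²×n² S-permutation matrices chosen uniformly at random (as an unordered pair) are disjoint equals ξ_n / ((n!)^(2n) − 1), where ξ_n is the number of S-permutation matrices disjoint with any fixed S-permutation matrix A (this number being independent of A). -/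
/-- The S-permutation matrix attached to a pair of families of permutations: the `1` of the block
`(k, l)` sits at position `(g.1 k l, g.2 l k)`. -/
def sPermMat {n : ℕ} (g : (Fin n → Equiv.Perm (Fin n)) × (Fin n → Equiv.Perm (Fin n))) :
    Matrix (Fin n × Fin n) (Fin n × Fin n) ℤ :=
  fun r c => if g.1 r.1 c.1 = r.2 ∧ g.2 c.1 r.1 = c.2 then 1 else 0

lemma sPermMat_eq_one_iff {n : ℕ}
    (g : (Fin n → Equiv.Perm (Fin n)) × (Fin n → Equiv.Perm (Fin n))) (r c : Fin n × Fin n) :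
    sPermMat g r c = 1 ↔ g.1 r.1 c.1 = r.2 ∧ g.2 c.1 r.1 = c.2 := by
  simp [sPermMat]

lemma sPermMat_injective {n : ℕ} : Function.Injective (sPermMat (n := n)) := by
  intro g h hgh
  have key (k l : Fin n) : h.1 k l = g.1 k l ∧ h.2 l k = g.2 l k := by
    rw [← sPermMat_eq_one_iff h (k, g.1 k l) (l, g.2 l k), ← hgh, sPermMat_eq_one_iff]
    exact ⟨rfl, rfl⟩
  ext k l
  · exact congrArg Fin.val (key k l).1.symm
  · exact congrArg Fin.val (key l k).2.symm

lemma isSPerm_sPermMat {n : ℕ}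
    (g : (Fin n → Equiv.Perm (Fin n)) × (Fin n → Equiv.Perm (Fin n))) :
    IsSPerm n (sPermMat g) := by
  simp only [IsSPerm, sPermMat_eq_one_iff]
  refine ⟨fun r c => ?_, fun r => ?_, fun c => ?_, fun k l => ?_⟩
  · unfold sPermMat
    split_ifs with h
    · exact Or.inr h
    · exact Or.inl rfl
  · refine ⟨((g.1 r.1).symm r.2, g.2 ((g.1 r.1).symm r.2) r.1), by simp, ?_⟩
    rintro ⟨l, j⟩ ⟨h₁, h₂⟩
    obtain rfl : l = (g.1 r.1).symm r.2 := by rw [← h₁, Equiv.symm_apply_apply]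
    exact Prod.ext rfl h₂.symm
  · refine ⟨((g.2 c.1).symm c.2, g.1 ((g.2 c.1).symm c.2) c.1), by simp, ?_⟩
    rintro ⟨k, i⟩ ⟨h₁, h₂⟩
    obtain rfl : k = (g.2 c.1).symm c.2 := by rw [← h₂, Equiv.symm_apply_apply]
    exact Prod.ext rfl h₁.symm
  · exact ⟨(g.1 k l, g.2 l k), ⟨rfl, rfl⟩, fun p hp => Prod.ext hp.1.symm hp.2.symm⟩

lemma IsSPerm.exists_eq_sPermMat {n : ℕ} {A : Matrix (Fin n × Fin n) (Fin n × Fin n) ℤ}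
    (hA : IsSPerm n A) : ∃ g, sPermMat g = A := by
  obtain ⟨hbin, hrow, hcol, hblock⟩ := hA
  choose p hp hpu using hblock
  have inj₁ (k : Fin n) : Function.Injective fun l => (p k l).1 := by
    intro l l' h
    have h' : (p k l).1 = (p k l').1 := h
    have e := hp k l
    simp only [h'] at e
    exact congrArg Prod.fst ((hrow _).unique e (hp k l'))
  have inj₂ (l : Fin n) : Function.Injective fun k => (p k l).2 := by
    intro k k' h
    have h' : (p k l).2 = (p k' l).2 := h
    have e := hp k l
    simp only [h'] at e
    exact congrArg Prod.fst ((hcol _).unique e (hp k' l))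
  refine ⟨(fun k => Equiv.ofBijective _ (Finite.injective_iff_bijective.1 (inj₁ k)),
    fun l => Equiv.ofBijective _ (Finite.injective_iff_bijective.1 (inj₂ l))), ?_⟩
  ext ⟨k, i⟩ ⟨l, j⟩
  simp only [sPermMat, Equiv.ofBijective_apply]
  split_ifs with h
  · rw [← h.1, ← h.2]
    exact (hp k l).symm
  · refine ((hbin _ _).resolve_right fun h₁ => h ?_).symm
    rw [← hpu k l (i, j) h₁]
    exact ⟨rfl, rfl⟩

lemma disjMat_sPermMat_iff {n : ℕ}
    (g h : (Fin n → Equiv.Perm (Fin n)) × (Fin n → Equiv.Perm (Fin n))) :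
    DisjMat n (sPermMat g) (sPermMat h) ↔ ∀ k l, ¬ (g.1 k l = h.1 k l ∧ g.2 l k = h.2 l k) := by
  simp only [DisjMat, sPermMat_eq_one_iff]
  constructor
  · intro H k l hkl
    exact H (k, h.1 k l) (l, h.2 l k) ⟨hkl, rfl, rfl⟩
  · rintro H r c ⟨h₁, h₂⟩
    exact H r.1 c.1 ⟨h₁.1.trans h₂.1.symm, h₁.2.trans h₂.2.symm⟩

lemma disjMat_sPermMat_mul_left_iff {n : ℕ}
    (a g h : (Fin n → Equiv.Perm (Fin n)) × (Fin n → Equiv.Perm (Fin n))) :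
    DisjMat n (sPermMat (a * g)) (sPermMat (a * h)) ↔ DisjMat n (sPermMat g) (sPermMat h) := by
  simp [disjMat_sPermMat_iff]

/-- The graph on pairs of families of permutations that joins two of them when their
S-permutation matrices are disjoint. -/
def disjGraph (n : ℕ) (hn : 0 < n) :
    SimpleGraph ((Fin n → Equiv.Perm (Fin n)) × (Fin n → Equiv.Perm (Fin n))) where
  Adj g h := DisjMat n (sPermMat g) (sPermMat h)
  symm := ⟨fun _ _ H i j h => H i j h.symm⟩
  loopless := ⟨fun g H =>
    (disjMat_sPermMat_iff g g).1 H ⟨0, hn⟩ ⟨0, hn⟩ ⟨rfl, rfl⟩⟩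

open Classical in
lemma disjGraph_degree_eq (n : ℕ) (hn : 0 < n)
    (g h : (Fin n → Equiv.Perm (Fin n)) × (Fin n → Equiv.Perm (Fin n))) :
    (disjGraph n hn).degree g = (disjGraph n hn).degree h := by
  let φ : disjGraph n hn ≃g disjGraph n hn :=
    ⟨Equiv.mulLeft (h * g⁻¹), disjMat_sPermMat_mul_left_iff _ _ _⟩
  have hφ : φ g = h := inv_mul_cancel_right h g
  rw [← hφ, φ.degree_eq]

open Classical in
lemma ncard_disjMat_sPermMat (n : ℕ) (hn : 0 < n)
    (g : (Fin n → Equiv.Perm (Fin n)) × (Fin n → Equiv.Perm (Fin n))) :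
    {B | IsSPerm n B ∧ DisjMat n (sPermMat g) B}.ncard = (disjGraph n hn).degree g := by
  have : {B | IsSPerm n B ∧ DisjMat n (sPermMat g) B} =
      sPermMat '' (↑((disjGraph n hn).neighborFinset g) :
        Set ((Fin n → Equiv.Perm (Fin n)) × (Fin n → Equiv.Perm (Fin n)))) := by
    ext B
    simp only [SimpleGraph.coe_neighborFinset, Set.mem_ofPred_eq, Set.mem_image,
      SimpleGraph.mem_neighborSet]
    constructor
    · rintro ⟨hB, hd⟩
      obtain ⟨h, rfl⟩ := hB.exists_eq_sPermMat
      exact ⟨h, hd, rfl⟩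
    · rintro ⟨h, hd, rfl⟩
      exact ⟨isSPerm_sPermMat h, hd⟩
  rw [this, Set.ncard_image_of_injective _ sPermMat_injective, Set.ncard_coe_finset,
    SimpleGraph.card_neighborFinset_eq_degree]

open Classical in
lemma ncard_disjoint_pairs (n : ℕ) (hn : 0 < n) :
    {S : Set (Matrix (Fin n × Fin n) (Fin n × Fin n) ℤ) |
        ∃ B₁ B₂, B₁ ≠ B₂ ∧ IsSPerm n B₁ ∧ IsSPerm n B₂ ∧ DisjMat n B₁ B₂ ∧
          S = {B₁, B₂}}.ncard = (disjGraph n hn).edgeFinset.card := by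
  have inj : Function.Injective fun e : Sym2 ((Fin n → Equiv.Perm (Fin n)) ×
      (Fin n → Equiv.Perm (Fin n))) => sPermMat '' (e : Set ((Fin n → Equiv.Perm (Fin n)) ×
        (Fin n → Equiv.Perm (Fin n)))) :=
    sPermMat_injective.image_injective.comp SetLike.coe_injective
  rw [← Set.ncard_coe_finset, ← Set.ncard_image_of_injective _ inj]
  congr 1
  ext S
  simp only [SimpleGraph.coe_edgeFinset, Set.mem_ofPred_eq, Set.mem_image]
  constructor
  · rintro ⟨B₁, B₂, -, h₁, h₂, hd, rfl⟩
    obtain ⟨g, rfl⟩ := h₁.exists_eq_sPermMat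
    obtain ⟨h, rfl⟩ := h₂.exists_eq_sPermMat
    exact ⟨s(g, h), hd, by simp [Set.image_pair]⟩
  · rintro ⟨e, he, rfl⟩
    induction e with
    | _ g h =>
      exact ⟨sPermMat g, sPermMat h, sPermMat_injective.ne ((disjGraph n hn).ne_of_adj he),
        isSPerm_sPermMat g, isSPerm_sPermMat h, he, by simp [Set.image_pair]⟩

/-- The probability that a uniformly random unordered pair of distinct S-permutation
matrices is disjoint equals ξₙ / ((n!)^(2n) − 1), where ξₙ is the number of
S-permutation matrices disjoint with any fixed S-permutation matrix A. -/
theorem prob_disjoint_eq (n : ℕ) (hn : 0 < n)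
    (A : Matrix (Fin n × Fin n) (Fin n × Fin n) ℤ) (hA : IsSPerm n A) :
    ({S : Set (Matrix (Fin n × Fin n) (Fin n × Fin n) ℤ) |
        ∃ B₁ B₂, B₁ ≠ B₂ ∧ IsSPerm n B₁ ∧ IsSPerm n B₂ ∧ DisjMat n B₁ B₂ ∧
          S = {B₁, B₂}}.ncard : ℚ) /
      ((n.factorial ^ (2 * n)).choose 2 : ℚ) =
    ({B : Matrix (Fin n × Fin n) (Fin n × Fin n) ℤ |
        IsSPerm n B ∧ DisjMat n A B}.ncard : ℚ) /
      ((n.factorial : ℚ) ^ (2 * n) - 1) := by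
  classical
  obtain ⟨g, rfl⟩ := hA.exists_eq_sPermMat
  rw [ncard_disjoint_pairs n hn, ncard_disjMat_sPermMat n hn g]
  have hsum := (disjGraph n hn).sum_degrees_eq_twice_card_edges
  rw [Finset.sum_congr rfl fun h _ => disjGraph_degree_eq n hn h g, Finset.sum_const,
    Finset.card_univ, smul_eq_mul] at hsum
  have hcard : Fintype.card ((Fin n → Equiv.Perm (Fin n)) × (Fin n → Equiv.Perm (Fin n))) =
      n.factorial ^ (2 * n) := by
    simp [Fintype.card_perm, two_mul, pow_add]
  rw [hcard] at hsum
  have hsum' : (n.factorial : ℚ) ^ (2 * n) * (disjGraph n hn).degree g =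
      2 * (disjGraph n hn).edgeFinset.card := by exact_mod_cast hsum
  have hpos : (n.factorial : ℚ) ^ (2 * n) ≠ 0 := by positivity
  rw [Nat.cast_choose_two, Nat.cast_pow]
  generalize (n.factorial : ℚ) ^ (2 * n) = M at *
  rw [div_div_eq_mul_div, mul_comm _ (2 : ℚ), ← hsum', mul_div_mul_left _ _ hpos]
end

section
/- Let n be a positive integer and let M be an n²×n² matrix with entries in {1, 2, …, n²}. Then M is a Sudoku matrix (i.e., every row, every column, and every one of the n² blocks of M contains each value from 1 to n² exactly once) if and only if there exist n²×n² S-permutation matrices A_1, A_2, …, A_{n²}, pairwise disjoint, such that M = 1·A_1 + 2·A_2 + ⋯ + n²·A_{n²}. -/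
/-- A Sudoku matrix: every row, every column, and every block contains each of the
values `1, …, n²` exactly once. -/
def IsSudoku (n : ℕ) (M : Matrix (Fin n × Fin n) (Fin n × Fin n) ℤ) : Prop :=
  (∀ r, ∀ v : ℤ, 1 ≤ v → v ≤ (n : ℤ) ^ 2 → ∃! c, M r c = v) ∧
  (∀ c, ∀ v : ℤ, 1 ≤ v → v ≤ (n : ℤ) ^ 2 → ∃! r, M r c = v) ∧
  (∀ k l : Fin n, ∀ v : ℤ, 1 ≤ v → v ≤ (n : ℤ) ^ 2 →
    ∃! p : Fin n × Fin n, M (k, p.1) (l, p.2) = v)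

/-- If the level sets of `M` are the supports of binary matrices `A s`, then `M` is a Sudoku
matrix exactly when every `A s` is an S-permutation matrix. -/
theorem isSudoku_iff_forall_isSPerm {n : ℕ} {M : Matrix (Fin n × Fin n) (Fin n × Fin n) ℤ}
    {A : Fin (n ^ 2) → Matrix (Fin n × Fin n) (Fin n × Fin n) ℤ}
    (hbin : ∀ s i j, A s i j = 0 ∨ A s i j = 1)
    (hA : ∀ s i j, A s i j = 1 ↔ M i j = (s : ℤ) + 1) :
    IsSudoku n M ↔ ∀ s, IsSPerm n (A s) := by
  have forall_value {P : ℤ → Prop} :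
      (∀ v : ℤ, 1 ≤ v → v ≤ (n : ℤ) ^ 2 → P v) ↔ ∀ s : Fin (n ^ 2), P ((s : ℤ) + 1) := by
    constructor
    · intro h s
      have hs : ((s : ℕ) : ℤ) < (n : ℤ) ^ 2 := by exact_mod_cast s.isLt
      exact h _ (by omega) (by omega)
    · intro h v hv hvn
      have hlt : (v - 1).toNat < n ^ 2 := by zify; omega
      have hval : (((v - 1).toNat : ℕ) : ℤ) + 1 = v := by omega
      simpa only [hval] using h ⟨(v - 1).toNat, hlt⟩
  simp only [IsSudoku, IsSPerm, forall_value, ← hA]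
  exact ⟨fun h s => ⟨hbin s, fun r => h.1 r s, fun c => h.2.1 c s, fun k l => h.2.2 k l s⟩,
    fun h => ⟨fun r s => (h s).2.1 r, fun c s => (h s).2.2.1 c, fun k l s => (h s).2.2.2 k l⟩⟩

/-- A matrix M with entries in {1, …, n²} is a Sudoku matrix iff it decomposes as
M = 1·A₁ + 2·A₂ + ⋯ + n²·A_{n²} for pairwise disjoint S-permutation matrices Aₛ. -/
theorem sudoku_iff_disjoint_sperm_decomposition (n : ℕ) (hn : 0 < n)
    (M : Matrix (Fin n × Fin n) (Fin n × Fin n) ℤ)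
    (hM : ∀ i j, 1 ≤ M i j ∧ M i j ≤ (n : ℤ) ^ 2) :
    IsSudoku n M ↔
      ∃ A : Fin (n ^ 2) → Matrix (Fin n × Fin n) (Fin n × Fin n) ℤ,
        (∀ s, IsSPerm n (A s)) ∧
        (∀ s t, s ≠ t → DisjMat n (A s) (A t)) ∧
        M = ∑ s : Fin (n ^ 2), ((s : ℤ) + 1) • A s := by
  constructor
  · intro hS
    let A : Fin (n ^ 2) → Matrix (Fin n × Fin n) (Fin n × Fin n) ℤ :=
      fun s i j => if M i j = (s : ℤ) + 1 then 1 else 0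
    have hA : ∀ s i j, A s i j = 1 ↔ M i j = (s : ℤ) + 1 := by simp [A]
    have hbin : ∀ s i j, A s i j = 0 ∨ A s i j = 1 := fun s i j =>
      (ite_eq_or_eq (M i j = (s : ℤ) + 1) (1 : ℤ) 0).symm
    refine ⟨A, (isSudoku_iff_forall_isSPerm hbin hA).1 hS, ?_, ?_⟩
    · rintro s t hst i j ⟨hs, ht⟩
      rw [hA] at hs ht
      exact hst (Fin.ext (by omega))
    · ext i j
      obtain ⟨h1, h2⟩ := hM i j
      have hlt : (M i j - 1).toNat < n ^ 2 := by zify; omega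
      have hs : M i j = (((⟨(M i j - 1).toNat, hlt⟩ : Fin (n ^ 2)) : ℕ) : ℤ) + 1 := by
        simp only; omega
      generalize (⟨(M i j - 1).toNat, hlt⟩ : Fin (n ^ 2)) = s at hs
      rw [Matrix.sum_apply, Finset.sum_eq_single s]
      · simp [(hA s i j).2 hs, hs]
      · intro t _ hts
        have : A t i j = 0 := (hbin t i j).resolve_right fun ht =>
          hts (Fin.ext (by have := (hA t i j).1 ht; omega))
        simp [this]
      · simp
  · rintro ⟨A, hSP, hdisj, hsum⟩
    have hbin : ∀ s i j, A s i j = 0 ∨ A s i j = 1 := fun s => (hSP s).1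
    have value_of_eq_one {s i j} (h : A s i j = 1) : M i j = (s : ℤ) + 1 := by
      rw [hsum, Matrix.sum_apply, Finset.sum_eq_single s]
      · simp [h]
      · intro t _ hts
        have : A t i j = 0 := (hbin t i j).resolve_right fun ht => hdisj t s hts i j ⟨ht, h⟩
        simp [this]
      · simp
    refine (isSudoku_iff_forall_isSPerm hbin fun s i j => ⟨value_of_eq_one, fun h => ?_⟩).2 hSP
    obtain ⟨t, ht⟩ : ∃ t, A t i j = 1 := by
      by_contra! hne
      have hzero : M i j = 0 := by
        rw [hsum, Matrix.sum_apply]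
        refine Finset.sum_eq_zero fun t _ => ?_
        simp [(hbin t i j).resolve_right (hne t)]
      have := (hM i j).1
      omega
    have hts := value_of_eq_one ht
    obtain rfl : t = s := Fin.ext (by omega)
    exact ht
end

section
/- Let n be a positive integer. Then σ_n = (n²)! · μ(n, n²), where σ_n is the number of n²×n² Sudoku matrices and μ(n, n²) is the number of unordered families (sets) of n² pairwise disjoint n²×n² S-permutation matrices. -/
/-- The binary matrix marking the cells of `M` that hold the value `v + 1`. -/
def layer (n : ℕ) (M : Matrix (Fin n × Fin n) (Fin n × Fin n) ℤ) (v : Fin (n ^ 2)) :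
    Matrix (Fin n × Fin n) (Fin n × Fin n) ℤ :=
  fun r c => if M r c = (v : ℤ) + 1 then 1 else 0

theorem layer_eq_one_iff {n : ℕ} {M : Matrix (Fin n × Fin n) (Fin n × Fin n) ℤ}
    {v : Fin (n ^ 2)} {r c : Fin n × Fin n} :
    layer n M v r c = 1 ↔ M r c = (v : ℤ) + 1 := by
  simp [layer]

/-- Sequences of `n²` pairwise disjoint S-permutation matrices. -/
def disjointSeqs (n : ℕ) :
    Set (Fin (n ^ 2) → Matrix (Fin n × Fin n) (Fin n × Fin n) ℤ) :=
  {g | (∀ v, IsSPerm n (g v)) ∧ ∀ v w, v ≠ w → DisjMat n (g v) (g w)}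

/-- Unordered families of `n²` pairwise disjoint S-permutation matrices. -/
def disjointFamilies (n : ℕ) : Set (Set (Matrix (Fin n × Fin n) (Fin n × Fin n) ℤ)) :=
  {F | (∀ A ∈ F, IsSPerm n A) ∧ F.ncard = n ^ 2 ∧
    (∀ A ∈ F, ∀ B ∈ F, A ≠ B → DisjMat n A B)}

theorem surjective_of_injective_cells {n : ℕ} {f : Fin (n ^ 2) → Fin n × Fin n}
    (hf : Function.Injective f) : Function.Surjective f :=
  ((Fintype.bijective_iff_injective_and_card f).2 ⟨hf, by simp [sq]⟩).2

theorem forall_value_iff {n : ℕ} {p : ℤ → Prop} :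
    (∀ v : ℤ, 1 ≤ v → v ≤ (n : ℤ) ^ 2 → p v) ↔ ∀ v : Fin (n ^ 2), p ((v : ℤ) + 1) := by
  constructor
  · intro h v
    have hv : (v : ℤ) < (n : ℤ) ^ 2 := by exact_mod_cast v.2
    exact h _ (by omega) (by omega)
  · intro h v h1 h2
    have hv : (v - 1).toNat < n ^ 2 := by
      zify
      omega
    have := h ⟨(v - 1).toNat, hv⟩
    rwa [show (((v - 1).toNat : ℕ) : ℤ) + 1 = v by omega] at this

theorem isSudoku_iff_layer {n : ℕ} {M : Matrix (Fin n × Fin n) (Fin n × Fin n) ℤ} :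
    IsSudoku n M ↔ ∀ v, IsSPerm n (layer n M v) := by
  simp only [IsSudoku, IsSPerm, forall_value_iff, layer_eq_one_iff]
  constructor
  · rintro ⟨h1, h2, h3⟩ v
    refine ⟨fun r c => ?_, fun r => h1 r v, fun c => h2 c v, fun k l => h3 k l v⟩
    by_cases hv : M r c = (v : ℤ) + 1 <;> simp [layer, hv]
  · intro h
    exact ⟨fun r v => (h v).2.1 r, fun c v => (h v).2.2.1 c, fun k l v => (h v).2.2.2 k l⟩

theorem IsSudoku.exists_value {n : ℕ} {M : Matrix (Fin n × Fin n) (Fin n × Fin n) ℤ}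
    (hM : IsSudoku n M) (r c : Fin n × Fin n) : ∃ v : Fin (n ^ 2), M r c = (v : ℤ) + 1 := by
  choose f hf _ using forall_value_iff.1 (hM.1 r)
  have hinj : Function.Injective f := by
    intro v w h
    have h1 := hf v
    have h2 := hf w
    simp only [h] at h1 h2
    exact Fin.ext (by omega)
  obtain ⟨v, rfl⟩ := surjective_of_injective_cells hinj c
  exact ⟨v, hf v⟩

theorem exists_eq_one_of_mem_disjointSeqs {n : ℕ}
    {g : Fin (n ^ 2) → Matrix (Fin n × Fin n) (Fin n × Fin n) ℤ} (hg : g ∈ disjointSeqs n)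
    (r c : Fin n × Fin n) : ∃ v, g v r c = 1 := by
  choose f hf _ using fun v => (hg.1 v).2.1 r
  have hinj : Function.Injective f := by
    intro v w h
    by_contra hvw
    exact hg.2 v w hvw r (f v) ⟨hf v, h ▸ hf w⟩
  obtain ⟨v, rfl⟩ := surjective_of_injective_cells hinj c
  exact ⟨v, hf v⟩

theorem layer_bijOn (n : ℕ) :
    Set.BijOn (layer n) {M | IsSudoku n M} (disjointSeqs n) := by
  refine ⟨fun M hM => ⟨isSudoku_iff_layer.1 hM, ?_⟩, fun M hM N _ h => ?_, fun g hg => ?_⟩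
  · rintro v w hvw r c ⟨hv, hw⟩
    rw [layer_eq_one_iff] at hv hw
    exact hvw (Fin.ext (by omega))
  · ext r c
    obtain ⟨v, hv⟩ := IsSudoku.exists_value hM r c
    rw [hv, eq_comm, ← layer_eq_one_iff, ← h, layer_eq_one_iff, hv]
  · choose f hf using exists_eq_one_of_mem_disjointSeqs hg
    have hlayer : layer n (fun r c => (f r c : ℤ) + 1) = g := by
      ext v r c
      by_cases hv : f r c = v
      · subst hv
        simp [layer, hf]
      · have hne : g v r c ≠ 1 := fun h => hg.2 _ _ hv r c ⟨hf r c, h⟩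
        have hv' : (f r c : ℕ) ≠ v := fun h => hv (Fin.ext h)
        simp [layer, hv', ((hg.1 v).1 r c).resolve_right hne]
    exact ⟨_, isSudoku_iff_layer.2 fun v => hlayer ▸ hg.1 v, hlayer⟩

theorem injective_of_mem_disjointSeqs {n : ℕ} (hn : 0 < n)
    {g : Fin (n ^ 2) → Matrix (Fin n × Fin n) (Fin n × Fin n) ℤ} (hg : g ∈ disjointSeqs n) :
    Function.Injective g := by
  intro v w h
  by_contra hvw
  obtain ⟨c, hc, _⟩ := (hg.1 v).2.1 (⟨0, hn⟩, ⟨0, hn⟩)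
  exact hg.2 v w hvw _ c ⟨hc, h ▸ hc⟩

theorem ncard_disjointSeqs {n : ℕ} (hn : 0 < n) :
    (disjointSeqs n).ncard = (n ^ 2).factorial * (disjointFamilies n).ncard := by
  have hequiv (F : disjointFamilies n) : Nonempty (Fin (n ^ 2) ≃ F.1) := by
    have hcard : Nat.card F.1 = n ^ 2 := F.2.2.1
    have : Finite F.1 := Nat.finite_of_card_ne_zero (by rw [hcard]; positivity)
    exact ⟨(Finite.equivFinOfCardEq hcard).symm⟩
  let e := fun F => (hequiv F).some
  let Φ : Equiv.Perm (Fin (n ^ 2)) × disjointFamilies n → disjointSeqs n := fun p =>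
    ⟨fun v => (e p.2 (p.1 v)).1, fun v => p.2.2.1 _ (e p.2 (p.1 v)).2, fun v w hvw =>
      p.2.2.2.2 _ (e p.2 (p.1 v)).2 _ (e p.2 (p.1 w)).2 fun h =>
        hvw (p.1.injective ((e p.2).injective (Subtype.ext h)))⟩
  have hrange (p) : Set.range (Φ p).1 = p.2.1 := by
    have : (Φ p).1 = Subtype.val ∘ (p.1.trans (e p.2)) := rfl
    rw [this, (p.1.trans (e p.2)).surjective.range_comp, Subtype.range_coe]
  have hΦ : Function.Bijective Φ := by
    constructor
    · rintro ⟨π, F⟩ ⟨ρ, G⟩ h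
      have hFG : F = G := Subtype.ext (by rw [← hrange (π, F), h, hrange])
      subst hFG
      refine Prod.ext (Equiv.ext fun v => (e F).injective (Subtype.ext ?_)) rfl
      exact congrFun (congrArg Subtype.val h) v
    · rintro ⟨g, hg⟩
      have hinj := injective_of_mem_disjointSeqs hn hg
      have hmem : Set.range g ∈ disjointFamilies n := by
        refine ⟨?_, ?_, ?_⟩
        · rintro _ ⟨v, rfl⟩
          exact hg.1 v
        · rw [← Set.image_univ, Set.ncard_image_of_injective _ hinj, Set.ncard_univ, Nat.card_fin]
        · rintro _ ⟨v, rfl⟩ _ ⟨w, rfl⟩ h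
          exact hg.2 v w fun hvw => h (congrArg g hvw)
      refine ⟨((Equiv.ofInjective g hinj).trans (e ⟨_, hmem⟩).symm, ⟨_, hmem⟩), Subtype.ext ?_⟩
      funext v
      simp [Φ]
  rw [← Nat.card_coe_set_eq, ← Nat.card_congr (Equiv.ofBijective Φ hΦ), Nat.card_prod,
    Nat.card_perm, Nat.card_fin, Nat.card_coe_set_eq]

/-- σₙ = (n²)! · μ(n, n²): the number of Sudoku matrices equals (n²)! times the number
of unordered families of n² pairwise disjoint S-permutation matrices. -/
theorem card_sudoku_eq (n : ℕ) (hn : 0 < n) :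
    {M : Matrix (Fin n × Fin n) (Fin n × Fin n) ℤ | IsSudoku n M}.ncard =
      (n ^ 2).factorial *
        {F : Set (Matrix (Fin n × Fin n) (Fin n × Fin n) ℤ) |
            (∀ A ∈ F, IsSPerm n A) ∧ F.ncard = n ^ 2 ∧
            (∀ A ∈ F, ∀ B ∈ F, A ≠ B → DisjMat n A B)}.ncard := by
  rw [← (layer_bijOn n).injOn.ncard_image, (layer_bijOn n).image_eq]
  exact ncard_disjointSeqs hn
end

section
/- The number of unordered families (sets) of 4 pairwise disjoint 4×4 S-permutation matrices (case n = 2) is exactly 12. -/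
/-- The `4 × 4` S-permutation matrix whose `1` in block `(k, l)` is at position
`(p.1 k + l, p.2 l + k)`. -/
def sPermOfShifts (p : (Fin 2 → Fin 2) × (Fin 2 → Fin 2)) :
    Matrix (Fin 2 × Fin 2) (Fin 2 × Fin 2) ℤ :=
  fun r c => if r.2 = p.1 r.1 + c.1 ∧ c.2 = p.2 c.1 + r.1 then 1 else 0

theorem sPermOfShifts_eq_one_iff (p : (Fin 2 → Fin 2) × (Fin 2 → Fin 2))
    (r c : Fin 2 × Fin 2) :
    sPermOfShifts p r c = 1 ↔ r.2 = p.1 r.1 + c.1 ∧ c.2 = p.2 c.1 + r.1 := by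
  simp [sPermOfShifts]

theorem isSPerm_sPermOfShifts (p : (Fin 2 → Fin 2) × (Fin 2 → Fin 2)) :
    IsSPerm 2 (sPermOfShifts p) := by
  refine ⟨fun i j => ?_, ?_⟩
  · unfold sPermOfShifts
    split_ifs <;> simp
  · simp only [sPermOfShifts_eq_one_iff, ExistsUnique]
    revert p
    decide +kernel

theorem sPermOfShifts_injective : Function.Injective sPermOfShifts := by
  intro p q h
  have key (k l : Fin 2) : p.1 k = q.1 k ∧ p.2 l = q.2 l := by
    have h₁ := (sPermOfShifts_eq_one_iff p (k, p.1 k + l) (l, p.2 l + k)).2 ⟨rfl, rfl⟩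
    rw [h, sPermOfShifts_eq_one_iff] at h₁
    exact ⟨add_right_cancel h₁.1, add_right_cancel h₁.2⟩
  exact Prod.ext (funext fun k => (key k 0).1) (funext fun l => (key 0 l).2)

theorem IsSPerm.exists_sPermOfShifts_eq {A : Matrix (Fin 2 × Fin 2) (Fin 2 × Fin 2) ℤ}
    (hA : IsSPerm 2 A) : ∃ p, sPermOfShifts p = A := by
  obtain ⟨hbin, hrow, hcol, hblock⟩ := hA
  choose f hf huniq using hblock
  have hrow_ne (k : Fin 2) : (f k 0).1 ≠ (f k 1).1 := fun h => by
    have h₀ := hf k 0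
    simp only [h] at h₀
    simpa using congrArg Prod.fst ((hrow _).unique h₀ (hf k 1))
  have hcol_ne (l : Fin 2) : (f 0 l).2 ≠ (f 1 l).2 := fun h => by
    have h₀ := hf 0 l
    simp only [h] at h₀
    simpa using congrArg Prod.fst ((hcol _).unique h₀ (hf 1 l))
  have hfst (k l : Fin 2) : (f k l).1 = (f k 0).1 + l := by
    have := hrow_ne k
    fin_cases l
    · simp
    · simp
      omega
  have hsnd (k l : Fin 2) : (f k l).2 = (f 0 l).2 + k := by
    have := hcol_ne l
    fin_cases k
    · simp
    · simp
      omega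
  refine ⟨(fun k => (f k 0).1, fun l => (f 0 l).2), ?_⟩
  ext ⟨k, i⟩ ⟨l, j⟩
  have hiff : A (k, i) (l, j) = 1 ↔ i = (f k 0).1 + l ∧ j = (f 0 l).2 + k := by
    rw [← hfst, ← hsnd]
    refine ⟨fun h => ?_, fun h => ?_⟩
    · have := huniq k l (i, j) h
      exact ⟨congrArg Prod.fst this, congrArg Prod.snd this⟩
    · rw [h.1, h.2]
      exact hf k l
  by_cases h : A (k, i) (l, j) = 1
  · rw [h, sPermOfShifts_eq_one_iff]
    exact hiff.1 h
  · rw [(hbin _ _).resolve_right h]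
    exact if_neg fun h' => h (hiff.2 h')

theorem disjMat_sPermOfShifts_iff (p q : (Fin 2 → Fin 2) × (Fin 2 → Fin 2)) :
    DisjMat 2 (sPermOfShifts p) (sPermOfShifts q) ↔
      ∀ k l, ¬ (p.1 k = q.1 k ∧ p.2 l = q.2 l) := by
  simp only [DisjMat, sPermOfShifts_eq_one_iff]
  refine ⟨fun h k l hkl => ?_, fun h r c hrc => ?_⟩
  · exact h (k, p.1 k + l) (l, p.2 l + k) ⟨⟨rfl, rfl⟩, by simp [hkl.1, hkl.2]⟩
  · exact h r.1 c.1 ⟨add_right_cancel (hrc.1.1.symm.trans hrc.2.1),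
      add_right_cancel (hrc.1.2.symm.trans hrc.2.2)⟩

theorem card_disjoint_shift_families :
    ((Finset.powersetCard 4 (Finset.univ : Finset ((Fin 2 → Fin 2) × (Fin 2 → Fin 2)))).filter
      fun F => ∀ p ∈ F, ∀ q ∈ F, p ≠ q →
        ∀ k l, ¬ (p.1 k = q.1 k ∧ p.2 l = q.2 l)).card = 12 := by
  decide +kernel

/-- Case n = 2: there are exactly 12 unordered families of 4 pairwise disjoint
4×4 S-permutation matrices. -/
theorem card_families_n2 :
    {F : Set (Matrix (Fin 2 × Fin 2) (Fin 2 × Fin 2) ℤ) |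
        (∀ A ∈ F, IsSPerm 2 A) ∧ F.ncard = 4 ∧
        (∀ A ∈ F, ∀ B ∈ F, A ≠ B → DisjMat 2 A B)}.ncard = 12 := by
  rw [← card_disjoint_shift_families, ← Set.ncard_coe_finset,
    ← Set.ncard_image_of_injective _
      (sPermOfShifts_injective.image_injective.comp Finset.coe_injective)]
  congr 1
  ext F
  simp only [Set.mem_ofPred_eq, Set.mem_image, Finset.mem_coe, Finset.mem_filter,
    Finset.mem_powersetCard_univ, Function.comp_apply]
  constructor
  · rintro ⟨hS, hcard, hdisj⟩
    obtain ⟨G, rfl⟩ := Set.subset_range_iff_exists_image_eq.1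
      fun A hA => (hS A hA).exists_sPermOfShifts_eq
    lift G to Finset ((Fin 2 → Fin 2) × (Fin 2 → Fin 2)) using G.toFinite
    rw [Set.ncard_image_of_injective _ sPermOfShifts_injective, Set.ncard_coe_finset] at hcard
    refine ⟨G, ⟨hcard, fun p hp q hq hpq => ?_⟩, rfl⟩
    exact (disjMat_sPermOfShifts_iff p q).1 (hdisj _ (Set.mem_image_of_mem _ hp) _
      (Set.mem_image_of_mem _ hq) (sPermOfShifts_injective.ne hpq))
  · rintro ⟨G, ⟨hcard, hdisj⟩, rfl⟩
    refine ⟨?_, ?_, ?_⟩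
    · rintro _ ⟨p, -, rfl⟩
      exact isSPerm_sPermOfShifts p
    · rw [Set.ncard_image_of_injective _ sPermOfShifts_injective, Set.ncard_coe_finset, hcard]
    · rintro _ ⟨p, hp, rfl⟩ _ ⟨q, hq, rfl⟩ hpq
      exact (disjMat_sPermOfShifts_iff p q).2 (hdisj p hp q hq (ne_of_apply_ne _ hpq))
end

section
/- The number of 4×4 Sudoku matrices (case n = 2) is exactly 288. -/
/-- A square filled with labels so that no row, column or block repeats a label. -/
def IsLatinSudoku {α : Type*} (N : Matrix (Fin 2 × Fin 2) (Fin 2 × Fin 2) α) : Prop :=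
  (∀ r, Function.Injective fun c => N r c) ∧
  (∀ c, Function.Injective fun r => N r c) ∧
  (∀ k l : Fin 2, Function.Injective fun p : Fin 2 × Fin 2 => N (k, p.1) (l, p.2))

theorem IsLatinSudoku.of_comp {α β : Type*} {N : Matrix (Fin 2 × Fin 2) (Fin 2 × Fin 2) α}
    {f : α → β} (h : IsLatinSudoku fun r c => f (N r c)) : IsLatinSudoku N :=
  ⟨fun r => (h.1 r).of_comp (f := f), fun c => (h.2.1 c).of_comp (f := f),
    fun k l => (h.2.2 k l).of_comp (f := f)⟩

theorem IsLatinSudoku.comp {α β : Type*} {N : Matrix (Fin 2 × Fin 2) (Fin 2 × Fin 2) α}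
    (h : IsLatinSudoku N) {f : α → β} (hf : Function.Injective f) :
    IsLatinSudoku fun r c => f (N r c) :=
  ⟨fun r => hf.comp (h.1 r), fun c => hf.comp (h.2.1 c), fun k l => hf.comp (h.2.2 k l)⟩

/-- A function on `m` points takes each of the values `1, …, m` exactly once iff it is
injective with values in `[1, m]`. -/
theorem forall_existsUnique_iff_injective {α : Type*} [Fintype α] {m : ℤ}
    (hm : (Fintype.card α : ℤ) = m) (f : α → ℤ) :
    (∀ v : ℤ, 1 ≤ v → v ≤ m → ∃! c, f c = v) ↔
      Function.Injective f ∧ ∀ c, f c ∈ Set.Icc 1 m := by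
  have hcard : Fintype.card α = Fintype.card (Set.Icc 1 m) := by
    simp only [Fintype.card_ofFinset, Int.card_Icc]
    simp [← hm]
  constructor
  · intro h
    choose g hg using fun v : Set.Icc 1 m => (h v v.2.1 v.2.2).exists
    have hginj : Function.Injective g := fun v w hvw => Subtype.ext (by rw [← hg v, ← hg w, hvw])
    have hgsurj := ((Fintype.bijective_iff_injective_and_card g).2 ⟨hginj, hcard.symm⟩).2
    have hrange : ∀ c, f c ∈ Set.Icc 1 m := by
      intro c
      obtain ⟨v, rfl⟩ := hgsurj c
      rw [hg]
      exact v.2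
    exact ⟨fun c d hcd => (h (f c) (hrange c).1 (hrange c).2).unique rfl hcd.symm, hrange⟩
  · rintro ⟨hinj, hrange⟩ v hv hvm
    have hbij := (Fintype.bijective_iff_injective_and_card
      (fun c => (⟨f c, hrange c⟩ : Set.Icc 1 m))).2
        ⟨fun c d hcd => hinj (congrArg Subtype.val hcd), hcard⟩
    obtain ⟨c, hc⟩ := hbij.2 ⟨v, hv, hvm⟩
    have hc' : f c = v := congrArg Subtype.val hc
    exact ⟨c, hc', fun d hd => hinj (hd.trans hc'.symm)⟩

theorem isSudoku_two_iff (M : Matrix (Fin 2 × Fin 2) (Fin 2 × Fin 2) ℤ) :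
    IsSudoku 2 M ↔ IsLatinSudoku M ∧ ∀ r c, M r c ∈ Set.Icc (1 : ℤ) 4 := by
  have hcard : (Fintype.card (Fin 2 × Fin 2) : ℤ) = ((2 : ℕ) : ℤ) ^ 2 := by simp
  have hfour : ((2 : ℕ) : ℤ) ^ 2 = 4 := by norm_num
  simp only [IsSudoku, IsLatinSudoku, forall_existsUnique_iff_injective hcard]
  rw [hfour]
  constructor
  · rintro ⟨h1, h2, h3⟩
    exact ⟨⟨fun r => (h1 r).1, fun c => (h2 c).1, fun k l => (h3 k l).1⟩, fun r => (h1 r).2⟩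
  · rintro ⟨⟨h1, h2, h3⟩, h⟩
    exact ⟨fun r => ⟨h1 r, h r⟩, fun c => ⟨h2 c, fun r => h r c⟩, fun k l => ⟨h3 k l, fun _ => h _ _⟩⟩

/-- The only candidate for the entry at position `(i, j)` of the lower right block, given that
the upper right block has rows `(1, a), (1, a + 1)` and `(0, b), (0, b + 1)` and the lower left
block has columns `(c, 1), (c + 1, 1)` and `(d, 0), (d + 1, 0)`. -/
def lowerRight (a b c d i j : Fin 2) : Fin 2 × Fin 2 :=
  if a = b then (if a + j = 0 then c + i + 1 else d + i + 1, a + j + 1)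
  else (c + i + 1, if c + i = 0 then a + j + 1 else b + j + 1)

/-- The filling whose upper left block is labelled by positions and whose other blocks are
prescribed by the second coordinates `a, b` of its entries in the first column of the upper right
block and the first coordinates `c, d` of its entries in the first row of the lower left block. -/
def normalForm (a b c d : Fin 2) : Matrix (Fin 2 × Fin 2) (Fin 2 × Fin 2) (Fin 2 × Fin 2) :=
  fun r s =>
    if r.1 = 0 then
      if s.1 = 0 then (r.2, s.2) else (r.2 + 1, (if r.2 = 0 then a else b) + s.2)
    else
      if s.1 = 0 then ((if s.2 = 0 then c else d) + r.2, s.2 + 1)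
      else lowerRight a b c d r.2 s.2

theorem isLatinSudoku_normalForm (a b c d : Fin 2) (h : a = b ∨ c = d) :
    IsLatinSudoku (normalForm a b c d) := by
  unfold IsLatinSudoku Function.Injective
  revert a b c d
  decide +kernel

theorem lowerRight_unique (a b c d i j : Fin 2) (w : Fin 2 × Fin 2) (h : a = b ∨ c = d)
    (h1 : w ≠ (1, a + j)) (h2 : w ≠ (0, b + j)) (h3 : w ≠ (c + i, 1)) (h4 : w ≠ (d + i, 0)) :
    w = lowerRight a b c d i j := by
  revert a b c d i j w
  decide +kernel

theorem lowerRight_collision (a b c d : Fin 2) (hab : a ≠ b) (hcd : c ≠ d) :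
    ∃ i j, ∀ w : Fin 2 × Fin 2,
      w = (1, a + j) ∨ w = (0, b + j) ∨ w = (c + i, 1) ∨ w = (d + i, 0) := by
  revert a b c d
  decide +kernel

theorem eq_of_avoid_fst (e : Fin 2) (x y : Fin 2 × Fin 2) (hx0 : x ≠ (e, 0)) (hx1 : x ≠ (e, 1))
    (hy0 : y ≠ (e, 0)) (hy1 : y ≠ (e, 1)) (hxy : x ≠ y) :
    x = (e + 1, x.2) ∧ y = (e + 1, x.2 + 1) := by
  revert e x y
  decide +kernel

theorem eq_of_avoid_snd (e : Fin 2) (x y : Fin 2 × Fin 2) (hx0 : x ≠ (0, e)) (hx1 : x ≠ (1, e))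
    (hy0 : y ≠ (0, e)) (hy1 : y ≠ (1, e)) (hxy : x ≠ y) :
    x = (x.1, e + 1) ∧ y = (x.1 + 1, e + 1) := by
  revert e x y
  decide +kernel

theorem IsLatinSudoku.exists_eq_normalForm
    {N : Matrix (Fin 2 × Fin 2) (Fin 2 × Fin 2) (Fin 2 × Fin 2)} (h : IsLatinSudoku N)
    (hN : ∀ i j, N (0, i) (0, j) = (i, j)) :
    ∃ a b c d : Fin 2, (a = b ∨ c = d) ∧ N = normalForm a b c d := by
  have row : ∀ r s t, s ≠ t → N r s ≠ N r t := fun r s t hst he => hst (h.1 r he)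
  have col : ∀ s r t, r ≠ t → N r s ≠ N t s := fun s r t hrt he => hrt (h.2.1 s he)
  have upper : ∀ i, N (0, i) (1, 0) = (i + 1, (N (0, i) (1, 0)).2) ∧
      N (0, i) (1, 1) = (i + 1, (N (0, i) (1, 0)).2 + 1) := by
    intro i
    have avoid (s t : Fin 2) : N (0, i) (1, t) ≠ (i, s) := hN i s ▸ row _ _ _ (by simp)
    exact eq_of_avoid_fst i _ _ (avoid 0 0) (avoid 1 0) (avoid 0 1) (avoid 1 1)
      (row _ _ _ (by simp))
  have lower : ∀ j, N (1, 0) (0, j) = ((N (1, 0) (0, j)).1, j + 1) ∧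
      N (1, 1) (0, j) = ((N (1, 0) (0, j)).1 + 1, j + 1) := by
    intro j
    have avoid (s t : Fin 2) : N (1, t) (0, j) ≠ (s, j) := hN s j ▸ col _ _ _ (by simp)
    exact eq_of_avoid_snd j _ _ (avoid 0 0) (avoid 1 0) (avoid 0 1) (avoid 1 1)
      (col _ _ _ (by simp))
  have upper' : ∀ i j, N (0, i) (1, j) = (i + 1, (N (0, i) (1, 0)).2 + j) := by
    intro i j
    fin_cases j
    · simpa using (upper i).1
    · exact (upper i).2
  have lower' : ∀ i j, N (1, i) (0, j) = ((N (1, 0) (0, j)).1 + i, j + 1) := by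
    intro i j
    fin_cases i
    · simpa using (lower j).1
    · exact (lower j).2
  have avoid : ∀ i j, N (1, i) (1, j) ≠ (1, (N (0, 0) (1, 0)).2 + j) ∧
      N (1, i) (1, j) ≠ (0, (N (0, 1) (1, 0)).2 + j) ∧
      N (1, i) (1, j) ≠ ((N (1, 0) (0, 0)).1 + i, 1) ∧
      N (1, i) (1, j) ≠ ((N (1, 0) (0, 1)).1 + i, 0) := by
    intro i j
    refine ⟨?_, ?_, ?_, ?_⟩
    · exact (upper' 0 j) ▸ col (1, j) (1, i) (0, 0) (by simp)
    · exact (upper' 1 j) ▸ col (1, j) (1, i) (0, 1) (by simp)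
    · exact (lower' i 0) ▸ row (1, i) (1, j) (0, 0) (by simp)
    · exact (lower' i 1) ▸ row (1, i) (1, j) (0, 1) (by simp)
  have hadm : (N (0, 0) (1, 0)).2 = (N (0, 1) (1, 0)).2 ∨
      (N (1, 0) (0, 0)).1 = (N (1, 0) (0, 1)).1 := by
    by_contra! hne
    obtain ⟨i, j, hij⟩ := lowerRight_collision _ _ _ _ hne.1 hne.2
    have := avoid i j
    have := hij (N (1, i) (1, j))
    tauto
  refine ⟨_, _, _, _, hadm, ?_⟩
  ext1 ⟨k, i⟩ ⟨l, j⟩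
  have hlast := lowerRight_unique _ _ _ _ i j _ hadm (avoid i j).1 (avoid i j).2.1
    (avoid i j).2.2.1 (avoid i j).2.2.2
  match k, l with
  | 0, 0 => simp [normalForm, hN]
  | 0, 1 =>
    rw [upper']
    fin_cases i <;> simp [normalForm]
  | 1, 0 =>
    rw [lower']
    fin_cases j <;> simp [normalForm]
  | 1, 1 => simpa [normalForm] using hlast

/-- The Sudoku matrix obtained from a normal form by naming its labels. -/
def relabel (x : ((Fin 2 × Fin 2) ≃ Set.Icc (1 : ℤ) 4) ×
    {q : Fin 2 × Fin 2 × Fin 2 × Fin 2 // q.1 = q.2.1 ∨ q.2.2.1 = q.2.2.2}) :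
    Matrix (Fin 2 × Fin 2) (Fin 2 × Fin 2) ℤ :=
  fun r s => x.1 (normalForm x.2.1.1 x.2.1.2.1 x.2.1.2.2.1 x.2.1.2.2.2 r s)

theorem normalForm_upperLeft (a b c d i j : Fin 2) :
    normalForm a b c d (0, i) (0, j) = (i, j) := by
  simp [normalForm]

theorem normalForm_injective {a b c d a' b' c' d' : Fin 2}
    (h : normalForm a b c d = normalForm a' b' c' d') :
    a = a' ∧ b = b' ∧ c = c' ∧ d = d' := by
  have h1 := congrFun₂ h (0, 0) (1, 0)
  have h2 := congrFun₂ h (0, 1) (1, 0)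
  have h3 := congrFun₂ h (1, 0) (0, 0)
  have h4 := congrFun₂ h (1, 0) (0, 1)
  simp [normalForm] at h1 h2 h3 h4
  exact ⟨h1, h2, h3, h4⟩

theorem relabel_injective : Function.Injective relabel := by
  rintro ⟨φ, ⟨a, b, c, d⟩, hq⟩ ⟨ψ, ⟨a', b', c', d'⟩, hq'⟩ h
  obtain rfl : φ = ψ := by
    ext ⟨i, j⟩
    simpa [relabel, normalForm_upperLeft] using congrFun₂ h (0, i) (0, j)
  have hnf : normalForm a b c d = normalForm a' b' c' d' := by
    ext1 r s
    exact φ.injective (Subtype.ext (congrFun₂ h r s))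
  obtain ⟨rfl, rfl, rfl, rfl⟩ := normalForm_injective hnf
  rfl

theorem range_relabel : Set.range relabel = {M | IsSudoku 2 M} := by
  ext M
  rw [Set.mem_ofPred_eq, isSudoku_two_iff]
  constructor
  · rintro ⟨⟨φ, ⟨⟨a, b, c, d⟩, hq⟩⟩, rfl⟩
    exact ⟨(isLatinSudoku_normalForm a b c d hq).comp
      (Subtype.val_injective.comp φ.injective), fun r s => (φ _).2⟩
  · rintro ⟨hM, hrange⟩
    let f : Fin 2 × Fin 2 → Set.Icc (1 : ℤ) 4 := fun p => ⟨M (0, p.1) (0, p.2), hrange _ _⟩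
    have hf : Function.Injective f := fun p q hpq => hM.2.2 0 0 (congrArg Subtype.val hpq)
    let φ := Equiv.ofBijective f
      ((Fintype.bijective_iff_injective_and_card f).2 ⟨hf, by simp⟩)
    let N : Matrix (Fin 2 × Fin 2) (Fin 2 × Fin 2) (Fin 2 × Fin 2) :=
      fun r s => φ.symm ⟨M r s, hrange r s⟩
    have hφN : ∀ r s, (φ (N r s) : ℤ) = M r s := fun r s => by simp [N]
    have hN : IsLatinSudoku N := by
      refine IsLatinSudoku.of_comp (f := fun p => (φ p : ℤ)) ?_
      simpa only [hφN] using hM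
    obtain ⟨a, b, c, d, hq, hNF⟩ := hN.exists_eq_normalForm
      fun i j => φ.symm_apply_eq.2 rfl
    refine ⟨⟨φ, ⟨⟨a, b, c, d⟩, hq⟩⟩, ?_⟩
    ext r s
    rw [← hφN, hNF]
    rfl

/-- Case n = 2: there are exactly 288 Sudoku matrices of size 4×4. -/
theorem card_sudoku_n2 :
    {M : Matrix (Fin 2 × Fin 2) (Fin 2 × Fin 2) ℤ | IsSudoku 2 M}.ncard = 288 := by
  rw [← range_relabel, ← Nat.card_coe_set_eq, Nat.card_range_of_injective relabel_injective,
    Nat.card_prod, Nat.card_eq_fintype_card, Nat.card_eq_fintype_card,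
    Fintype.card_equiv (Fintype.equivOfCardEq (by simp))]
  have hparam : Fintype.card
      {q : Fin 2 × Fin 2 × Fin 2 × Fin 2 // q.1 = q.2.1 ∨ q.2.2.1 = q.2.2.2} = 12 := by
    decide
  rw [hparam]
  simp [Nat.factorial]
end
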